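/- arXiv:2403.07748 — 3 statements merged into one kernel-verified Lean document; each statement's English description precedes it below -/
import Mathlib

section
/- In every state reached along an execution of Trémaux's depth-first search algorithm, the origin r has no incident dart marked F, every visited vertex v ≠ r has exactly one incident dart (v,w) with μ(v,w)=F, and from every visited vertex, iterating the map sending a vertex v ≠ r to the head w of its unique F-marked dart (v,w) reaches the origin r in finitely many steps; that is, the F-marked darts form a tree on the visited vertices directed toward r. -/
/-!
Trémaux's depth-first search.  A dart of `G` is an ordered pair of adjacent
vertices.  Markers: `none` (unmarked), `E` (Explored), `B` (Backtrack),
`F` (First entry).  A state records the marking, the agent's position and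
the set of visited vertices.
-/

namespace Tremaux

inductive Mk : Type
  | none | E | B | F
  deriving DecidableEq

structure St (V : Type*) where
  μ : V → V → Mk
  pos : V
  vis : Set V

variable {V : Type*} [DecidableEq V]

/-- Update the marker of the dart `(u, v)`. -/
def upd (μ : V → V → Mk) (u v : V) (c : Mk) : V → V → Mk :=
  fun a b => if a = u ∧ b = v then c else μ a b

/-- One move of the agent, applying the first applicable rule (T1)–(T3);
the label records the traversed dart. -/
inductive Step (G : SimpleGraph V) : St V → V × V → St V → Prop
  | t1 (s : St V) (v : V) (hadj : G.Adj s.pos v)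
      (hB : s.μ s.pos v = Mk.B) :
      Step G s (s.pos, v) ⟨upd s.μ s.pos v Mk.E, v, s.vis⟩
  | t2_new (s : St V) (v : V) (hadj : G.Adj s.pos v)
      (hnoB : ∀ w, G.Adj s.pos w → s.μ s.pos w ≠ Mk.B)
      (h0 : s.μ s.pos v = Mk.none) (hv : v ∉ s.vis) :
      Step G s (s.pos, v)
        ⟨upd (upd s.μ s.pos v Mk.E) v s.pos Mk.F, v, insert v s.vis⟩
  | t2_old (s : St V) (v : V) (hadj : G.Adj s.pos v)
      (hnoB : ∀ w, G.Adj s.pos w → s.μ s.pos w ≠ Mk.B)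
      (h0 : s.μ s.pos v = Mk.none) (hv : v ∈ s.vis) :
      Step G s (s.pos, v)
        ⟨upd (upd s.μ s.pos v Mk.E) v s.pos Mk.B, v, insert v s.vis⟩
  | t3 (s : St V) (v : V) (hadj : G.Adj s.pos v)
      (hnoB : ∀ w, G.Adj s.pos w → s.μ s.pos w ≠ Mk.B)
      (hno0 : ∀ w, G.Adj s.pos w → s.μ s.pos w ≠ Mk.none)
      (hF : s.μ s.pos v = Mk.F) :
      Step G s (s.pos, v) ⟨s.μ, v, s.vis⟩

/-- The initial state at the origin `r`. -/
def init (r : V) : St V := ⟨fun _ _ => Mk.none, r, {r}⟩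

/-- `f 0, …, f k` is an execution of Trémaux's algorithm from the origin `r`,
where the `i`-th move traverses the dart `d i`. -/
def IsExec (G : SimpleGraph V) (r : V) (k : ℕ) (f : ℕ → St V) (d : ℕ → V × V) : Prop :=
  f 0 = init r ∧ ∀ i < k, Step G (f i) (d i) (f (i + 1))

end Tremaux

namespace Tremaux

/-- The dart `(a, b)` of `G` starts away from `r` and is marked `F`. -/
def IsParent {V : Type*} (G : SimpleGraph V) (r : V) (μ : V → V → Mk) (a b : V) : Prop :=
  a ≠ r ∧ G.Adj a b ∧ μ a b = Mk.F

/-- The invariant maintained by the moves of Trémaux's algorithm. -/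
structure Inv {V : Type*} (G : SimpleGraph V) (r : V) (s : St V) : Prop where
  root_mem : r ∈ s.vis
  pos_mem : s.pos ∈ s.vis
  none_symm : ∀ a b, s.μ a b = Mk.none → s.μ b a = Mk.none
  mem_of_marked : ∀ a b, s.μ a b ≠ Mk.none → a ∈ s.vis
  root_not_F : ∀ b, s.μ r b ≠ Mk.F
  unique_F : ∀ a b c, s.μ a b = Mk.F → s.μ a c = Mk.F → b = c
  reach : ∀ v ∈ s.vis, Relation.ReflTransGen (IsParent G r s.μ) v r

theorem Inv.init {V : Type*} (G : SimpleGraph V) (r : V) : Inv G r (init r) := by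
  refine ⟨rfl, rfl, fun _ _ _ => rfl, fun _ _ h => absurd rfl h, ?_, ?_, ?_⟩
  · intro b h
    cases h
  · intro a b c h
    cases h
  · intro v hv
    obtain rfl : v = r := hv
    exact .refl

theorem Inv.head_mem_of_marked {V : Type*} {G : SimpleGraph V} {r : V} {s : St V}
    (h : Inv G r s) {a b : V} (hab : s.μ a b ≠ Mk.none) : b ∈ s.vis :=
  h.mem_of_marked b a fun hba => hab (h.none_symm b a hba)

/-- The invariant survives a move to a visited vertex that does not change the `F`-marked darts. -/
theorem Inv.of_F_iff {V : Type*} {G : SimpleGraph V} {r : V} {s : St V} (h : Inv G r s)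
    {μ : V → V → Mk} {v : V} (hv : v ∈ s.vis)
    (hnone : ∀ a b, μ a b = Mk.none → μ b a = Mk.none)
    (hmem : ∀ a b, μ a b ≠ Mk.none → a ∈ s.vis)
    (hF : ∀ a b, μ a b = Mk.F ↔ s.μ a b = Mk.F) : Inv G r ⟨μ, v, s.vis⟩ := by
  have hP : IsParent G r μ = IsParent G r s.μ := by
    ext a b
    simp [IsParent, hF]
  exact ⟨h.root_mem, hv, hnone, hmem, fun b hb => h.root_not_F b ((hF r b).1 hb),
    fun a b c hb hc => h.unique_F a b c ((hF a b).1 hb) ((hF a c).1 hc),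
    by simpa only [hP] using h.reach⟩

theorem Inv.step {V : Type*} [DecidableEq V] {G : SimpleGraph V} {r : V} {s t : St V}
    {d : V × V} (h : Inv G r s) (hst : Step G s d t) : Inv G r t := by
  have hpos := h.pos_mem
  have hsymm := h.none_symm
  have hmarked := h.mem_of_marked
  cases hst with
  | t1 v hadj hB =>
    have hv : v ∈ s.vis := h.head_mem_of_marked (a := s.pos) (by simp [hB])
    refine h.of_F_iff hv ?_ ?_ ?_ <;> intro a b <;> simp only [upd] <;> grind
  | t2_new v hadj hnoB h0 hv =>
    have hne := hadj.ne
    have hroot := h.root_mem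
    have hrootF := h.root_not_F
    have huniq := h.unique_F
    have hvr : v ≠ r := by grind
    have hunmarked : ∀ b, s.μ v b = Mk.none := by grind
    have hmono : ∀ a b, IsParent G r s.μ a b →
        IsParent G r (upd (upd s.μ s.pos v Mk.E) v s.pos Mk.F) a b := by
      rintro a b ⟨har, hab, hF⟩
      refine ⟨har, hab, ?_⟩
      simp only [upd]
      grind
    have hreach : ∀ w ∈ s.vis, Relation.ReflTransGen
        (IsParent G r (upd (upd s.μ s.pos v Mk.E) v s.pos Mk.F)) w r :=
      fun w hw => Relation.ReflTransGen.mono hmono _ _ (h.reach w hw)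
    refine ⟨Set.mem_insert_of_mem v hroot, Set.mem_insert v s.vis, ?_, ?_, ?_, ?_, ?_⟩
    · intro a b
      simp only [upd]
      grind
    · intro a b
      simp only [upd, Set.mem_insert_iff]
      grind
    · intro b
      simp only [upd]
      grind
    · intro a b c
      simp only [upd]
      grind
    · intro w hw
      rcases hw with rfl | hw
      · exact .head ⟨hvr, hadj.symm, by simp [upd]⟩ (hreach _ hpos)
      · exact hreach w hw
  | t2_old v hadj hnoB h0 hv =>
    have h0' := hsymm _ _ h0
    rw [Set.insert_eq_of_mem hv]
    refine h.of_F_iff hv ?_ ?_ ?_ <;> intro a b <;> simp only [upd] <;> grind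
  | t3 v hadj hnoB hno0 hF =>
    exact h.of_F_iff (h.head_mem_of_marked (a := s.pos) (by simp [hF])) hsymm hmarked
      fun _ _ => Iff.rfl

theorem IsExec.inv {V : Type*} [DecidableEq V] {G : SimpleGraph V} {r : V} {k : ℕ}
    {f : ℕ → St V} {d : ℕ → V × V} (h : IsExec G r k f d) : ∀ i ≤ k, Inv G r (f i) := by
  intro i
  induction i with
  | zero =>
    intro _
    rw [h.1]
    exact Inv.init G r
  | succ i ih =>
    intro hi
    exact (ih (by omega)).step (h.2 i hi)

end Tremaux

theorem Relation.ReflTransGen.exists_seq {α : Type*} {R : α → α → Prop} {a b : α}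
    (h : Relation.ReflTransGen R a b) :
    ∃ (j : ℕ) (x : ℕ → α), x 0 = a ∧ x j = b ∧ ∀ l < j, R (x l) (x (l + 1)) := by
  induction h using Relation.ReflTransGen.head_induction_on with
  | refl => exact ⟨0, fun _ => b, rfl, rfl, by simp⟩
  | @head a c hac _ ih =>
    obtain ⟨j, x, hx0, hxj, hx⟩ := ih
    refine ⟨j + 1, fun n => Nat.casesOn n a x, rfl, hxj, ?_⟩
    rintro (_ | l) hl
    · simpa [hx0] using hac
    · exact hx l (by omega)

open Tremaux in
/-- Along any execution of Trémaux's algorithm: the origin has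
no incident `F`-marked dart, every other visited vertex has exactly one
incident `F`-marked dart, and iterating the `F`-parent map from any visited
vertex reaches the origin in finitely many steps (the `F`-darts form a tree on
the visited vertices directed toward `r`). -/
theorem tremaux_F_darts_tree {V : Type*} [Fintype V] [DecidableEq V]
    (G : SimpleGraph V) [Fintype G.edgeSet] (hG : G.Connected) (r : V) :
    ∀ (k : ℕ) (f : ℕ → St V) (d : ℕ → V × V),
      IsExec G r k f d → ∀ i ≤ k,
      (∀ w, G.Adj r w → (f i).μ r w ≠ Mk.F) ∧
      (∀ v ∈ (f i).vis, v ≠ r → ∃! w, G.Adj v w ∧ (f i).μ v w = Mk.F) ∧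
      (∀ v ∈ (f i).vis, ∃ (j : ℕ) (x : ℕ → V), x 0 = v ∧ x j = r ∧
        ∀ l < j, x l ≠ r ∧ G.Adj (x l) (x (l + 1)) ∧
          (f i).μ (x l) (x (l + 1)) = Mk.F) := by
  intro k f d hexec i hi
  have h := hexec.inv i hi
  refine ⟨fun w _ => h.root_not_F w, ?_, fun v hv => (h.reach v hv).exists_seq⟩
  intro v hv hvr
  rcases (h.reach v hv).cases_head with rfl | ⟨w, ⟨_, hadj, hF⟩, _⟩
  · exact absurd rfl hvr
  · exact ⟨w, ⟨hadj, hF⟩, fun c hc => h.unique_F v c w hc.2 hF⟩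
end

section
/- If in some state reached along an asynchronous execution of the two-agent exploration algorithm one agent is at a vertex all of whose incident darts are marked D, then both agents occupy the same vertex and every edge of G has been traversed exactly twice. -/
/-!
Two-agent asynchronous collective exploration.  Markers:
`none` (unmarked), `E` (Explored), `B` (Backtrack), `F` (First entry),
`D` (Done, traversed twice).  A state records the marking, the positions of
the two agents and the set of visited vertices.
-/

namespace TwoExplore

inductive Mk : Type
  | none | E | B | F | D
  deriving DecidableEq

structure St (V : Type*) where
  μ : V → V → Mk
  p1 : V
  p2 : V
  vis : Set V

variable {V : Type*} [DecidableEq V]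

/-- Update the marker of the dart `(u, v)`. -/
def upd (μ : V → V → Mk) (u v : V) (c : Mk) : V → V → Mk :=
  fun a b => if a = u ∧ b = v then c else μ a b

/-- Position of agent `b` (`true` = first agent, `false` = second agent). -/
def pos (s : St V) (b : Bool) : V := if b then s.p1 else s.p2

/-- The state obtained from `s` by moving agent `b` to `v`, with new marking
`μ'` and new visited set `vis'`. -/
def moveTo (s : St V) (b : Bool) (v : V) (μ' : V → V → Mk) (vis' : Set V) : St V :=
  ⟨μ', if b then v else s.p1, if b then s.p2 else v, vis'⟩

/-- One asynchronous move: agent `b` applies the first applicable rule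
(R1)–(R5); the label records the agent and the traversed dart. -/
inductive Step (G : SimpleGraph V) : St V → Bool × (V × V) → St V → Prop
  | r1 (s : St V) (b : Bool) (v : V) (hadj : G.Adj (pos s b) v)
      (hB : s.μ (pos s b) v = Mk.B) :
      Step G s (b, (pos s b, v))
        (moveTo s b v (upd (upd s.μ (pos s b) v Mk.D) v (pos s b) Mk.D) s.vis)
  | r2 (s : St V) (b : Bool) (v : V) (hadj : G.Adj (pos s b) v)
      (hnoB : ∀ w, G.Adj (pos s b) w → s.μ (pos s b) w ≠ Mk.B)
      (h0 : s.μ (pos s b) v = Mk.none) (hE : s.μ v (pos s b) = Mk.E) :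
      Step G s (b, (pos s b, v))
        (moveTo s b v (upd (upd s.μ (pos s b) v Mk.E) v (pos s b) Mk.D) s.vis)
  | r3_new (s : St V) (b : Bool) (v : V) (hadj : G.Adj (pos s b) v)
      (hnoB : ∀ w, G.Adj (pos s b) w → s.μ (pos s b) w ≠ Mk.B)
      (hnoRev : ∀ w, G.Adj (pos s b) w →
        ¬(s.μ (pos s b) w = Mk.none ∧ s.μ w (pos s b) = Mk.E))
      (h0 : s.μ (pos s b) v = Mk.none) (hv : v ∉ s.vis) :
      Step G s (b, (pos s b, v))
        (moveTo s b v (upd (upd s.μ (pos s b) v Mk.E) v (pos s b) Mk.F)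
          (insert v s.vis))
  | r3_old (s : St V) (b : Bool) (v : V) (hadj : G.Adj (pos s b) v)
      (hnoB : ∀ w, G.Adj (pos s b) w → s.μ (pos s b) w ≠ Mk.B)
      (hnoRev : ∀ w, G.Adj (pos s b) w →
        ¬(s.μ (pos s b) w = Mk.none ∧ s.μ w (pos s b) = Mk.E))
      (h0 : s.μ (pos s b) v = Mk.none) (hv : v ∈ s.vis) :
      Step G s (b, (pos s b, v))
        (moveTo s b v (upd (upd s.μ (pos s b) v Mk.E) v (pos s b) Mk.B)
          (insert v s.vis))
  | r4 (s : St V) (b : Bool) (v : V) (hadj : G.Adj (pos s b) v)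
      (hnoB : ∀ w, G.Adj (pos s b) w → s.μ (pos s b) w ≠ Mk.B)
      (hno0 : ∀ w, G.Adj (pos s b) w → s.μ (pos s b) w ≠ Mk.none)
      (hF : s.μ (pos s b) v = Mk.F) :
      Step G s (b, (pos s b, v))
        (moveTo s b v (upd (upd s.μ (pos s b) v Mk.D) v (pos s b) Mk.D) s.vis)
  | r5 (s : St V) (b : Bool) (v : V) (hadj : G.Adj (pos s b) v)
      (hnoB : ∀ w, G.Adj (pos s b) w → s.μ (pos s b) w ≠ Mk.B)
      (hno0 : ∀ w, G.Adj (pos s b) w → s.μ (pos s b) w ≠ Mk.none)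
      (hnoF : ∀ w, G.Adj (pos s b) w → s.μ (pos s b) w ≠ Mk.F)
      (hE : s.μ (pos s b) v = Mk.E) :
      Step G s (b, (pos s b, v))
        (moveTo s b v (upd (upd s.μ (pos s b) v Mk.D) v (pos s b) Mk.D) s.vis)

/-- The initial state: both agents at the origin `r`. -/
def init (r : V) : St V := ⟨fun _ _ => Mk.none, r, r, {r}⟩

/-- `f 0, …, f k` is an asynchronous execution, where at round `i` the
adversarially chosen agent `(lbl i).1` traverses the dart `(lbl i).2`. -/
def IsExec (G : SimpleGraph V) (r : V) (k : ℕ) (f : ℕ → St V)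
    (lbl : ℕ → Bool × (V × V)) : Prop :=
  f 0 = init r ∧ ∀ i < k, Step G (f i) (lbl i) (f (i + 1))

/-- Number of times the edge `{u, v}` has been traversed (in either direction)
during the first `i` moves. -/
def edgeCount (lbl : ℕ → Bool × (V × V)) (i : ℕ) (u v : V) : ℕ :=
  ((Finset.range i).filter fun j => (lbl j).2 = (u, v) ∨ (lbl j).2 = (v, u)).card

end TwoExplore

namespace TwoExplore

/-- Number of traversals of an edge one of whose darts carries the given marker. -/
def Mk.weight : Mk → ℕ
  | .none => 0
  | .E => 1
  | .B => 1
  | .F => 1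
  | .D => 2

/-- Number of darts out of `x` whose marker satisfies `P`. -/
def cnt {V : Type*} [Fintype V] (P : Mk → Prop) [DecidablePred P] (μ : V → V → Mk) (x : V) : ℕ :=
  ∑ w, if P (μ x w) then 1 else 0

/-- Number of agents at `x`. -/
def agentCount {V : Type*} [DecidableEq V] (s : St V) (x : V) : ℕ :=
  (if s.p1 = x then 1 else 0) + (if s.p2 = x then 1 else 0)

theorem cnt_pos {V : Type*} [Fintype V] {P : Mk → Prop} [DecidablePred P] {μ : V → V → Mk} {x y : V}
    (h : P (μ x y)) : 0 < cnt P μ x :=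
  lt_of_lt_of_le (by simp [h]) (Finset.single_le_sum
    (f := fun w => if P (μ x w) then 1 else 0) (fun _ _ => Nat.zero_le _) (Finset.mem_univ y))

theorem cnt_eq_zero {V : Type*} [Fintype V] {P : Mk → Prop} [DecidablePred P] {μ : V → V → Mk} {x : V}
    (h : ∀ y, ¬ P (μ x y)) : cnt P μ x = 0 :=
  Finset.sum_eq_zero fun y _ => by simp [h y]

theorem cnt_eq_one {V : Type*} [Fintype V] {P : Mk → Prop} [DecidablePred P] {μ : V → V → Mk} {x y : V}
    (hy : P (μ x y)) (h : ∀ z, z ≠ y → ¬ P (μ x z)) : cnt P μ x = 1 := by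
  unfold cnt
  rw [Finset.sum_eq_single y (fun z _ hz => by simp [h z hz]) (by simp)]
  simp [hy]

section Counting

variable {V : Type*} [DecidableEq V]

theorem cnt_upd [Fintype V] (P : Mk → Prop) [DecidablePred P] (μ : V → V → Mk) (u v : V) (c : Mk)
    (x : V) :
    cnt P (upd μ u v c) x + (if x = u ∧ P (μ u v) then 1 else 0) =
      cnt P μ x + (if x = u ∧ P c then 1 else 0) := by
  unfold cnt
  by_cases hx : x = u
  · subst hx
    rw [← Finset.add_sum_erase _ _ (Finset.mem_univ v),
      ← Finset.add_sum_erase (a := v) Finset.univ (fun w => if P (μ x w) then 1 else 0)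
        (Finset.mem_univ v)]
    have : ∑ w ∈ Finset.univ.erase v, (if P (upd μ x v c x w) then 1 else 0) =
        ∑ w ∈ Finset.univ.erase v, (if P (μ x w) then 1 else 0) := by
      refine Finset.sum_congr rfl fun w hw => ?_
      simp [upd, Finset.ne_of_mem_erase hw]
    rw [this]
    simp only [upd, true_and, and_self, if_true]
    omega
  · simp [upd, hx]

theorem cnt_upd_upd [Fintype V] (P : Mk → Prop) [DecidablePred P] (μ : V → V → Mk) {u v : V}
    (huv : u ≠ v) (c d : Mk) (x : V) :
    cnt P (upd (upd μ u v c) v u d) x + (if x = u ∧ P (μ u v) then 1 else 0) +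
        (if x = v ∧ P (μ v u) then 1 else 0) =
      cnt P μ x + (if x = u ∧ P c then 1 else 0) + (if x = v ∧ P d then 1 else 0) := by
  have h1 := cnt_upd P μ u v c x
  have h2 := cnt_upd P (upd μ u v c) v u d x
  have h3 : upd μ u v c v u = μ v u := by simp [upd, huv]
  rw [h3] at h2
  omega

theorem agentCount_moveTo (s : St V) (b : Bool) (v : V) (μ' : V → V → Mk) (vis' : Set V) (x : V) :
    agentCount (moveTo s b v μ' vis') x + (if x = pos s b then 1 else 0) =
      agentCount s x + (if x = v then 1 else 0) := by
  cases b <;> simp only [agentCount, moveTo, pos, eq_comm (a := x)] <;> simp <;> omega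

theorem agentCount_pos (s : St V) (b : Bool) : 0 < agentCount s (pos s b) := by
  cases b <;> simp [agentCount, pos]

end Counting

/-- A dart is *open* when its edge has been traversed exactly once. -/
def Mk.Open (c : Mk) : Prop := c = .E ∨ c = .B ∨ c = .F

instance : DecidablePred Mk.Open := fun c => by unfold Mk.Open; infer_instance

/-- The possible pairs of markers on the two darts of an edge. -/
def Mk.Compat : Mk → Mk → Prop
  | .none, .none => True
  | .E, .B => True
  | .E, .F => True
  | .B, .E => True
  | .F, .E => True
  | .D, .D => True
  | _, _ => False

/-- The invariant satisfied by every reachable state. -/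
structure Inv {V : Type*} [DecidableEq V] [Fintype V] (G : SimpleGraph V) (r : V) (s : St V) :
    Prop where
  compat : ∀ x y, Mk.Compat (s.μ x y) (s.μ y x)
  adj : ∀ x y, s.μ x y ≠ .none → G.Adj x y
  vis_of_marked : ∀ x y, s.μ x y ≠ .none → x ∈ s.vis
  vis_origin : r ∈ s.vis
  vis_agent : ∀ x, 0 < agentCount s x → x ∈ s.vis
  rank : ∃ t : V → ℕ, ∀ x y, s.μ x y = .F → t y < t x
  first_unique : ∀ x y z, s.μ x y = .F → s.μ x z = .F → y = z
  back_le : ∀ x, cnt (· = Mk.B) s.μ x ≤ agentCount s x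
  parity : ∀ x, Even (cnt Mk.Open s.μ x + agentCount s x)
  unmarked : ∀ x ∈ s.vis, ∀ y, G.Adj x y → s.μ x y = .none →
    (∃ z, s.μ x z = .E ∨ s.μ x z = .F) ∨ cnt (· = Mk.B) s.μ x < agentCount s x

section Invariant

variable {V : Type*} [DecidableEq V]

/-- The three kinds of moves that occur from states satisfying the invariant, for an agent
moving along `(u, v)` with new markers `c` on `(u, v)` and `d` on `(v, u)`. -/
inductive Kind (G : SimpleGraph V) (s : St V) (u v : V) : Mk → Mk → Set V → Prop
  | close (ho : Mk.Open (s.μ u v))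
      (h : s.μ u v = .B ∨ (∀ w, G.Adj u w → s.μ u w ≠ .B) ∧ ∀ w, G.Adj u w → s.μ u w ≠ .none) :
      Kind G s u v .D .D s.vis
  | fresh (h0 : s.μ u v = .none) (hB : ∀ w, G.Adj u w → s.μ u w ≠ .B) (hv : v ∉ s.vis) :
      Kind G s u v .E .F (insert v s.vis)
  | seen (h0 : s.μ u v = .none) (hB : ∀ w, G.Adj u w → s.μ u w ≠ .B) (hv : v ∈ s.vis) :
      Kind G s u v .E .B (insert v s.vis)

theorem Step.kind [Fintype V] {G : SimpleGraph V} {r : V} {s s' : St V} {l : Bool × (V × V)}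
    (hs : Inv G r s) (h : Step G s l s') :
    ∃ b v c d vis', G.Adj (pos s b) v ∧ l.2 = (pos s b, v) ∧ Kind G s (pos s b) v c d vis' ∧
      s' = moveTo s b v (upd (upd s.μ (pos s b) v c) v (pos s b) d) vis' := by
  cases h with
  | r1 b v hadj hB =>
    exact ⟨b, v, _, _, _, hadj, rfl, .close (.inr (.inl hB)) (.inl hB), rfl⟩
  | r2 b v hadj hnoB h0 hE =>
    have := hs.compat (pos s b) v
    simp [h0, hE, Mk.Compat] at this
  | r3_new b v hadj hnoB hnoRev h0 hv =>
    exact ⟨b, v, _, _, _, hadj, rfl, .fresh h0 hnoB hv, rfl⟩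
  | r3_old b v hadj hnoB hnoRev h0 hv =>
    exact ⟨b, v, _, _, _, hadj, rfl, .seen h0 hnoB hv, rfl⟩
  | r4 b v hadj hnoB hno0 hF =>
    exact ⟨b, v, _, _, _, hadj, rfl, .close (.inr (.inr hF)) (.inr ⟨hnoB, hno0⟩), rfl⟩
  | r5 b v hadj hnoB hno0 hnoF hE =>
    exact ⟨b, v, _, _, _, hadj, rfl, .close (.inl hE) (.inr ⟨hnoB, hno0⟩), rfl⟩

theorem upd_upd_apply (μ : V → V → Mk) {u v : V} (huv : u ≠ v) (c d : Mk) (x y : V) :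
    (x = u ∧ y = v ∧ upd (upd μ u v c) v u d x y = c) ∨
    (x = v ∧ y = u ∧ upd (upd μ u v c) v u d x y = d) ∨
    (¬(x = u ∧ y = v) ∧ ¬(x = v ∧ y = u) ∧ upd (upd μ u v c) v u d x y = μ x y) := by
  unfold upd
  grind

theorem Mk.Compat.symm {c d : Mk} (h : Mk.Compat c d) : Mk.Compat d c := by
  cases c <;> cases d <;> simp_all [Mk.Compat]

theorem Mk.Compat.open_right {c d : Mk} (h : Mk.Compat c d) (hc : c.Open) : d.Open := by
  cases c <;> cases d <;> simp_all [Mk.Compat, Mk.Open]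

theorem Mk.Compat.none_right {d : Mk} (h : Mk.Compat .none d) : d = .none := by
  cases d <;> simp_all [Mk.Compat]

theorem Mk.Compat.weight_eq {c d : Mk} (h : Mk.Compat c d) : c.weight = d.weight := by
  cases c <;> cases d <;> simp_all [Mk.Compat, Mk.weight]

theorem Mk.Open.weight_eq {c : Mk} (h : c.Open) : c.weight = 1 := by
  rcases h with rfl | rfl | rfl <;> rfl

theorem Inv.init [Fintype V] (G : SimpleGraph V) (r : V) : Inv G r (init r) where
  compat _ _ := trivial
  adj _ _ h := (h rfl).elim
  vis_of_marked _ _ h := (h rfl).elim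
  vis_origin := rfl
  vis_agent x h := by
    by_contra hx
    have hx' : r ≠ x := fun h => hx h.symm
    simp [agentCount, TwoExplore.init, hx'] at h
  rank := ⟨fun _ => 0, fun _ _ h => by simp [TwoExplore.init] at h⟩
  first_unique _ _ _ h := by simp [TwoExplore.init] at h
  back_le x := by simp [cnt, TwoExplore.init]
  parity x := by
    rw [cnt_eq_zero (by simp [TwoExplore.init, Mk.Open]), zero_add]
    exact ⟨_, rfl⟩
  unmarked x hx y _ _ := by
    have hx' : x = r := hx
    subst hx'
    right
    rw [cnt_eq_zero (by simp [TwoExplore.init])]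
    simp [agentCount, TwoExplore.init]

theorem Inv.move [Fintype V] {G : SimpleGraph V} {r : V} {s : St V} (hs : Inv G r s) {b : Bool}
    {v : V} {c d : Mk} {vis' : Set V} (hadj : G.Adj (pos s b) v)
    (hk : Kind G s (pos s b) v c d vis') :
    Inv G r (moveTo s b v (upd (upd s.μ (pos s b) v c) v (pos s b) d) vis') := by
  have hag := agentCount_moveTo s b v (upd (upd s.μ (pos s b) v c) v (pos s b) d) vis'
  have hpos := agentCount_pos s b
  have hu := hs.vis_agent _ hpos
  set u := pos s b with hu_def
  have huv : u ≠ v := hadj.ne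
  set μ' := upd (upd s.μ u v c) v u d with hμ'
  set s' := moveTo s b v μ' vis' with hs'
  have hsμ : s'.μ = μ' := rfl
  have hsv : s'.vis = vis' := rfl
  have hap := upd_upd_apply s.μ huv c d
  rw [← hμ'] at hap
  have hcB := cnt_upd_upd (· = Mk.B) s.μ huv c d
  have hcO := cnt_upd_upd Mk.Open s.μ huv c d
  rw [← hμ'] at hcB hcO
  have hcuv := hs.compat u v
  have hback := hs.back_le
  have hsub : s.vis ⊆ vis' := by
    cases hk
    · exact subset_rfl
    all_goals exact Set.subset_insert _ _
  have hvv : v ∈ vis' := by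
    cases hk with
    | close ho h =>
      refine hs.vis_of_marked v u fun h => ?_
      have := hcuv.open_right ho
      rw [h] at this
      simp [Mk.Open] at this
    | fresh => exact Set.mem_insert _ _
    | seen => exact Set.mem_insert _ _
  have hB0 : s.μ u v ≠ .B → cnt (· = Mk.B) s.μ u = 0 := by
    intro h
    refine cnt_eq_zero fun y hy => ?_
    have hya := hs.adj u y (by rw [hy]; decide)
    cases hk with
    | close ho h' => exact (h'.resolve_left h).1 y hya hy
    | fresh h0 hB => exact hB y hya hy
    | seen h0 hB => exact hB y hya hy
  have hcd : Mk.Compat c d := by cases hk <;> trivial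
  have hcn : c ≠ .none ∧ d ≠ .none := by cases hk <;> decide
  have hback' : ∀ x, cnt (· = Mk.B) μ' x ≤ agentCount s' x := by
    intro x
    have h1 := hag x
    have h2 := hcB x
    have h3 := hback x
    have hcb : c ≠ .B := by cases hk <;> decide
    by_cases hxu : x = u
    · subst hxu
      by_cases hB : s.μ u v = .B
      · simp [huv, hB, hcb] at h1 h2
        omega
      · have := hB0 hB
        simp [huv, hB, hcb] at h1 h2
        omega
    · by_cases hxv : x = v
      · subst hxv
        simp [huv.symm] at h1 h2
        split_ifs at h2 <;> omega
      · simp [hxu, hxv] at h1 h2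
        omega
  refine ⟨?_, ?_, ?_, ?_, ?_, ?_, ?_, hback', ?_, ?_⟩
  · intro x y
    rw [hsμ]
    have h1 := hap x y
    have h2 := hap y x
    have h3 := hs.compat x y
    have h4 := hcd.symm
    grind
  · intro x y h
    rw [hsμ] at h
    have h1 := hs.adj x y
    have h2 := hap x y
    have h3 := hadj.symm
    grind
  · intro x y h
    rw [hsμ] at h
    have h1 := hs.vis_of_marked x y
    rcases hap x y with ⟨rfl, -, -⟩ | ⟨rfl, -, -⟩ | ⟨-, -, h2⟩
    · exact hsub hu
    · exact hvv
    · exact hsub (h1 (h2 ▸ h))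
  · exact hsub hs.vis_origin
  · intro x hx
    have h1 := hag x
    by_cases hxv : x = v
    · exact hxv ▸ hvv
    · refine hsub (hs.vis_agent x ?_)
      simp only [hxv, if_false] at h1
      omega
  · obtain ⟨t, ht⟩ := hs.rank
    rw [hsμ]
    cases hk with
    | close ho h =>
      refine ⟨t, fun x y h => ?_⟩
      have := hap x y
      grind
    | seen h0 hB hv =>
      refine ⟨t, fun x y h => ?_⟩
      have := hap x y
      grind
    | fresh h0 hB hv =>
      refine ⟨Function.update t v (t u + 1), fun x y h => ?_⟩
      rcases hap x y with ⟨-, -, h1⟩ | ⟨rfl, rfl, h1⟩ | ⟨-, -, h1⟩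
      · rw [h1] at h
        cases h
      · simp [huv]
      · rw [h1] at h
        have hxv : x ≠ v := fun hxv => hv (hxv ▸ hs.vis_of_marked x y (by rw [h]; decide))
        have hyv : y ≠ v := by
          intro hyv
          refine hv (hyv ▸ hs.vis_of_marked y x fun h2 => ?_)
          have := hs.compat x y
          rw [h, h2] at this
          exact this
        simpa [hxv, hyv] using ht x y h
  · intro x y z
    rw [hsμ]
    have h1 := hs.first_unique x y z
    have h2 := hap x y
    have h3 := hap x z
    cases hk with
    | close ho h => grind
    | seen h0 hB hv => grind
    | fresh h0 hB hv =>
      have h4 := hs.vis_of_marked x y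
      have h5 := hs.vis_of_marked x z
      grind
  · intro x
    have h1 := hag x
    have h2 := hcO x
    have h3 := hs.parity x
    rw [hsμ]
    rw [Nat.even_iff] at h3 ⊢
    have hflip : (Mk.Open c ↔ ¬ Mk.Open (s.μ u v)) ∧ (Mk.Open d ↔ ¬ Mk.Open (s.μ v u)) := by
      cases hk with
      | close ho h =>
        have hD : ¬ Mk.Open .D := by decide
        simp only [ho, hcuv.open_right ho, hD, not_true, and_self]
      | fresh h0 _ _ =>
        rw [h0] at hcuv
        simp [h0, hcuv.none_right, Mk.Open]
      | seen h0 _ _ =>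
        rw [h0] at hcuv
        simp [h0, hcuv.none_right, Mk.Open]
    simp only [hflip.1, hflip.2] at h2
    by_cases hxu : x = u
    · subst hxu
      by_cases ho : Mk.Open (s.μ u v) <;> simp [huv, ho] at h1 h2 <;> omega
    · by_cases hxv : x = v
      · subst hxv
        by_cases ho : Mk.Open (s.μ x u) <;> simp [huv.symm, ho] at h1 h2 <;> omega
      · simp [hxu, hxv] at h1 h2
        omega
  · intro x hx y hxy h0
    rw [hsμ] at h0 ⊢
    rw [hsv] at hx
    have h0' : s.μ x y = .none := by
      rcases hap x y with ⟨-, -, h⟩ | ⟨-, -, h⟩ | ⟨-, -, h⟩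
      · exact (hcn.1 (h ▸ h0)).elim
      · exact (hcn.2 (h ▸ h0)).elim
      · exact h ▸ h0
    have h1 := hag x
    have h2 := hcB x
    have h3 := hback x
    have hvx : v ≠ u := huv.symm
    by_cases hxu : x = u
    · subst hxu
      cases hk with
      | close ho h =>
        rcases h with h | h
        · rcases hs.unmarked u hu y hxy h0' with ⟨z, hz⟩ | h4
          · left
            refine ⟨z, ?_⟩
            have := hap u z
            grind
          · right
            simp [huv, h] at h1 h2
            omega
        · exact (h.2 y hxy h0').elim
      | fresh _ _ _ =>
        left
        refine ⟨v, .inl ?_⟩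
        have := hap u v
        grind
      | seen _ _ _ =>
        left
        refine ⟨v, .inl ?_⟩
        have := hap u v
        grind
    · by_cases hxv : x = v
      · subst hxv
        cases hk with
        | close ho h =>
          right
          simp [hvx] at h1 h2
          split_ifs at h2 <;> omega
        | fresh _ _ _ =>
          left
          refine ⟨u, .inr ?_⟩
          have := hap x u
          grind
        | seen hn _ hv =>
          rw [hn] at hcuv
          have hn' := hcuv.none_right
          rcases hs.unmarked x hv y hxy h0' with ⟨z, hz⟩ | h4
          · left
            refine ⟨z, ?_⟩
            have := hap x z
            grind
          · right
            simp [hvx, hn'] at h1 h2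
            omega
      · have hxs : x ∈ s.vis := by
          cases hk with
          | close => exact hx
          | fresh => exact hx.resolve_left hxv
          | seen => exact hx.resolve_left hxv
        have heq : ∀ z, μ' x z = s.μ x z := fun z => by
          have := hap x z
          grind
        simp only [heq]
        simp [hxu, hxv] at h1 h2
        rw [h1, h2]
        exact hs.unmarked x hxs y hxy h0'

theorem Kind.weight_move [Fintype V] {G : SimpleGraph V} {r : V} {s : St V} (hs : Inv G r s)
    {u v : V} {c d : Mk} {vis' : Set V} (hadj : G.Adj u v) (hk : Kind G s u v c d vis')
    (x y : V) :
    (upd (upd s.μ u v c) v u d x y).weight =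
      (s.μ x y).weight + (if (u, v) = (x, y) ∨ (u, v) = (y, x) then 1 else 0) := by
  have hw := (hs.compat u v).weight_eq
  have hc : c.weight = (s.μ u v).weight + 1 ∧ d.weight = (s.μ u v).weight + 1 := by
    cases hk with
    | close ho h => rw [ho.weight_eq]; exact ⟨rfl, rfl⟩
    | fresh h0 _ _ => simp [h0, Mk.weight]
    | seen h0 _ _ => simp [h0, Mk.weight]
  rcases upd_upd_apply s.μ hadj.ne c d x y with ⟨rfl, rfl, h⟩ | ⟨rfl, rfl, h⟩ | ⟨h1, h2, h⟩
  · simp [h, hc.1]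
  · simp [h, hc.2, hw]
  · rw [h, if_neg]
    · rfl
    · simp only [Prod.mk.injEq]
      grind

theorem edgeCount_succ (lbl : ℕ → Bool × (V × V)) (i : ℕ) (x y : V) :
    edgeCount lbl (i + 1) x y =
      edgeCount lbl i x y + (if (lbl i).2 = (x, y) ∨ (lbl i).2 = (y, x) then 1 else 0) := by
  unfold edgeCount
  rw [Finset.range_add_one, Finset.filter_insert]
  split_ifs <;> simp

theorem IsExec.inv_and_edgeCount [Fintype V] {G : SimpleGraph V} {r : V} {k : ℕ} {f : ℕ → St V}
    {lbl : ℕ → Bool × (V × V)} (h : IsExec G r k f lbl) (i : ℕ) (hi : i ≤ k) :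
    Inv G r (f i) ∧ ∀ x y, edgeCount lbl i x y = ((f i).μ x y).weight := by
  induction i with
  | zero =>
    rw [h.1]
    exact ⟨Inv.init G r, fun x y => rfl⟩
  | succ i ih =>
    obtain ⟨hs, hc⟩ := ih (by omega)
    obtain ⟨b, v, c, d, vis', hadj, hl, hk, he⟩ := (h.2 i hi).kind hs
    rw [he]
    refine ⟨hs.move hadj hk, fun x y => ?_⟩
    rw [edgeCount_succ, hc, hl]
    exact (hk.weight_move hs hadj x y).symm

theorem Inv.colocated [Fintype V] {G : SimpleGraph V} {r : V} {s : St V} (hs : Inv G r s)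
    {b : Bool} (hD : ∀ w, G.Adj (pos s b) w → s.μ (pos s b) w = .D) : s.p1 = s.p2 := by
  have h0 : cnt Mk.Open s.μ (pos s b) = 0 := by
    refine cnt_eq_zero fun y hy => ?_
    have hne : s.μ (pos s b) y ≠ .none := by
      intro h
      simp [h, Mk.Open] at hy
    simp [hD y (hs.adj _ _ hne), Mk.Open] at hy
  have hp := hs.parity (pos s b)
  rw [h0, Nat.even_iff] at hp
  by_contra hne
  cases b <;> simp [agentCount, pos, hne, Ne.symm hne] at hp

theorem Inv.all_done [Fintype V] {G : SimpleGraph V} {r : V} {s : St V} (hs : Inv G r s)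
    (hG : G.Connected) {b : Bool} (hD : ∀ w, G.Adj (pos s b) w → s.μ (pos s b) w = .D)
    (x y : V) (hxy : G.Adj x y) : s.μ x y = .D := by
  have hco := hs.colocated hD
  have hag : ∀ x, x ≠ pos s b → agentCount s x = 0 := by
    intro x hx
    cases b <;> simp_all [agentCount, pos, eq_comm]
  have hat : ∀ x y, s.μ x y ≠ .none → s.μ x y ≠ .D → x ≠ pos s b := by
    rintro x y h1 h2 rfl
    exact h2 (hD y (hs.adj _ _ h1))
  have hB : ∀ x y, s.μ x y ≠ .B := by
    intro x y h
    have h1 := cnt_pos (P := (· = Mk.B)) h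
    have h2 := hs.back_le x
    have h3 := hag x (hat x y (by rw [h]; decide) (by rw [h]; decide))
    omega
  have hEF : ∀ x y, s.μ x y = .E → s.μ y x = .F := by
    intro x y h
    have h1 := hs.compat x y
    have h2 := hB y x
    rw [h] at h1
    cases h3 : s.μ y x <;> simp_all [Mk.Compat]
  have hF : ∀ x y, s.μ x y ≠ .F := by
    obtain ⟨t, ht⟩ := hs.rank
    by_contra! hcon
    obtain ⟨x, ⟨y, hy⟩, hmax⟩ := (Set.toFinite {x | ∃ y, s.μ x y = .F}).exists_maximalFor t _ hcon
    have h1 : cnt Mk.Open s.μ x = 1 := by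
      refine cnt_eq_one (y := y) (.inr (.inr hy)) fun z hz ho => ?_
      rcases ho with h | h | h
      · have h2 := hEF x z h
        have h3 := ht z x h2
        have h4 := hmax ⟨x, h2⟩ h3.le
        omega
      · exact hB x z h
      · exact hz (hs.first_unique x z y h hy)
    have h2 := hs.parity x
    rw [h1, hag x (hat x y (by rw [hy]; decide) (by rw [hy]; decide))] at h2
    exact absurd h2 (by decide)
  have hE : ∀ x y, s.μ x y ≠ .E := fun x y h => hF y x (hEF x y h)
  have hvis : ∀ x ∈ s.vis, ∀ y, G.Adj x y → s.μ x y = .D := by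
    intro x hx y hxy
    by_cases hxp : x = pos s b
    · subst hxp
      exact hD y hxy
    · cases h : s.μ x y with
      | none =>
        rcases hs.unmarked x hx y hxy h with ⟨z, hz | hz⟩ | h1
        · exact (hE x z hz).elim
        · exact (hF x z hz).elim
        · rw [hag x hxp] at h1
          omega
      | E => exact (hE x y h).elim
      | B => exact (hB x y h).elim
      | F => exact (hF x y h).elim
      | D => rfl
  have hall : ∀ x, x ∈ s.vis := by
    intro x
    have hr := (hG.preconnected x r).symm
    rw [SimpleGraph.reachable_iff_reflTransGen] at hr
    induction hr with
    | refl => exact hs.vis_origin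
    | @tail y z _ hyz ih =>
      have h1 := hs.compat y z
      rw [hvis y ih z hyz] at h1
      refine hs.vis_of_marked z y fun h => ?_
      rw [h] at h1
      exact h1
  exact hvis x (hall x) y hxy

end Invariant

end TwoExplore

open TwoExplore in
/-- If along an asynchronous execution of the two-agent
exploration algorithm some agent is at a vertex all of whose incident darts
are marked `D`, then the two agents are co-located and every edge has been
traversed exactly twice. -/
theorem two_agent_termination {V : Type*} [Fintype V] [DecidableEq V]
    (G : SimpleGraph V) [Fintype G.edgeSet] (hG : G.Connected) (r : V)
    (k : ℕ) (f : ℕ → St V) (lbl : ℕ → Bool × (V × V))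
    (hexec : IsExec G r k f lbl) :
    ∀ i ≤ k, ∀ b : Bool,
      (∀ w, G.Adj (pos (f i) b) w → (f i).μ (pos (f i) b) w = Mk.D) →
      (f i).p1 = (f i).p2 ∧
      ∀ u v : V, G.Adj u v → edgeCount lbl i u v = 2 := by
  intro i hi b hD
  obtain ⟨hs, hc⟩ := hexec.inv_and_edgeCount i hi
  refine ⟨hs.colocated hD, fun u v huv => ?_⟩
  rw [hc, hs.all_done hG hD u v huv]
  rfl
end

section
/- Every maximal synchronous execution of the two-agent exploration algorithm lasts exactly m time-steps; when it terminates, every edge of G has been traversed exactly twice and the two agents occupy the same vertex. -/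
/-!
Two-agent asynchronous collective exploration.  Markers:
`none` (unmarked), `E` (Explored), `B` (Backtrack), `F` (First entry),
`D` (Done, traversed twice).  A state records the marking, the positions of
the two agents and the set of visited vertices.
-/

namespace TwoExplore

variable {V : Type*} [DecidableEq V]

/-! ### Synchronous semantics -/

/-- Departure-marker update of the navigation table
(`B ↦ D`, `∅ ↦ E`, `F ↦ D`, `E ↦ D`). -/
def depMk : Mk → Mk
  | Mk.B => Mk.D
  | Mk.none => Mk.E
  | Mk.F => Mk.D
  | Mk.E => Mk.D
  | Mk.D => Mk.D

/-- `Sel G μ u v` : an agent located at `u` may select the dart `(u, v)`,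
according to the rule priority (R1)–(R5) read on the marking `μ`. -/
def Sel (G : SimpleGraph V) (μ : V → V → Mk) (u v : V) : Prop :=
  G.Adj u v ∧
  (μ u v = Mk.B ∨
   ((∀ w, G.Adj u w → μ u w ≠ Mk.B) ∧ μ u v = Mk.none ∧ μ v u = Mk.E) ∨
   ((∀ w, G.Adj u w → μ u w ≠ Mk.B) ∧
      (∀ w, G.Adj u w → ¬(μ u w = Mk.none ∧ μ w u = Mk.E)) ∧
      μ u v = Mk.none) ∨
   ((∀ w, G.Adj u w → μ u w ≠ Mk.B) ∧ (∀ w, G.Adj u w → μ u w ≠ Mk.none) ∧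
      μ u v = Mk.F) ∨
   ((∀ w, G.Adj u w → μ u w ≠ Mk.B) ∧ (∀ w, G.Adj u w → μ u w ≠ Mk.none) ∧
      (∀ w, G.Adj u w → μ u w ≠ Mk.F) ∧ μ u v = Mk.E))

/-- Arrival-marker update: an agent that selected a dart whose original marker
was `o` and arrives through a dart currently marked `c` writes `res`; if
`o = ∅` it writes `D` when it reads `E`, and otherwise `B` or `F` according to
whether the arrival vertex was already discovered. -/
def ArrOK (o c : Mk) (visited : Prop) (res : Mk) : Prop :=
  (o ≠ Mk.none ∧ res = Mk.D) ∨
  (o = Mk.none ∧ c = Mk.E ∧ res = Mk.D) ∨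
  (o = Mk.none ∧ c ≠ Mk.E ∧ visited ∧ res = Mk.B) ∨
  (o = Mk.none ∧ c ≠ Mk.E ∧ ¬ visited ∧ res = Mk.F)

/-- Original marker of the dart selected by the first agent. -/
def o1 (s : St V) (d1 : V × V) : Mk := s.μ d1.1 d1.2

/-- Marking after the departure update of the first agent. -/
def μdep1 (s : St V) (d1 : V × V) : V → V → Mk :=
  upd s.μ d1.1 d1.2 (depMk (o1 s d1))

/-- Marker of the dart selected by the second agent as the second agent reads
it (after the first agent's departure update when they are co-located). -/
def o2 (s : St V) (d1 d2 : V × V) : Mk := μdep1 s d1 d2.1 d2.2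

/-- Marking after both departure updates. -/
def μdep (s : St V) (d1 d2 : V × V) : V → V → Mk :=
  upd (μdep1 s d1) d2.1 d2.2 (depMk (o2 s d1 d2))

/-- One synchronous time-step: each agent selects a dart by the rule priority
(when co-located, the second agent selects after the first agent's departure
update), both departure updates are performed, both agents traverse their
darts, and both arrival updates are performed reading the marking left by the
two departure updates. -/
def SyncStep (G : SimpleGraph V) (s : St V) (d1 d2 : V × V) (s' : St V) : Prop :=
  d1.1 = s.p1 ∧ d2.1 = s.p2 ∧
  Sel G s.μ s.p1 d1.2 ∧
  ((s.p1 ≠ s.p2 ∧ Sel G s.μ s.p2 d2.2) ∨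
   (s.p1 = s.p2 ∧ Sel G (μdep1 s d1) s.p2 d2.2)) ∧
  ∃ r1 r2 : Mk,
    ArrOK (o1 s d1) (μdep s d1 d2 d1.2 d1.1) (d1.2 ∈ s.vis) r1 ∧
    ArrOK (o2 s d1 d2) (μdep s d1 d2 d2.2 d2.1) (d2.2 ∈ s.vis) r2 ∧
    s' = ⟨upd (upd (μdep s d1 d2) d1.2 d1.1 r1) d2.2 d2.1 r2, d1.2, d2.2,
          s.vis ∪ {x | (o1 s d1 = Mk.none ∧ x = d1.2) ∨
                       (o2 s d1 d2 = Mk.none ∧ x = d2.2)}⟩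

end TwoExplore

namespace TwoExplore

section Markers

/-- Contribution of a dart to the net outflow of once-traversed edges at its source. -/
def Mk.flow : Mk → ℤ
  | none => 0
  | E => 1
  | B => -1
  | F => -1
  | D => 0

/-- Number of times an edge has been traversed, read off one of its darts. -/
def Mk.uses : Mk → ℕ
  | none => 0
  | E => 1
  | B => 1
  | F => 1
  | D => 2

/-- Indicator of the marker `c`. -/
def Mk.ind (c d : Mk) : ℤ := if d = c then 1 else 0

theorem Mk.ind_nonneg (c d : Mk) : 0 ≤ c.ind d := by
  unfold Mk.ind
  split_ifs <;> simp

theorem Mk.flow_nonpos {c : Mk} (h : c ≠ Mk.E) : c.flow ≤ 0 := by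
  cases c <;> simp_all [Mk.flow]

theorem Mk.flow_nonneg {c : Mk} (h : c ≠ Mk.F) (h' : c ≠ Mk.B) : 0 ≤ c.flow := by
  cases c <;> simp_all [Mk.flow]

/-- The pairs of markers that the two darts of an edge may carry between time-steps. -/
def Compatible (c d : Mk) : Prop :=
  (c = Mk.none ∧ d = Mk.none) ∨ (c = Mk.D ∧ d = Mk.D) ∨
    (c = Mk.E ∧ (d = Mk.F ∨ d = Mk.B)) ∨ (d = Mk.E ∧ (c = Mk.F ∨ c = Mk.B))

/-- Sign of the flow created along a dart marked `o` when it is traversed. -/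
def Mk.sign (o : Mk) : ℤ := if o = Mk.E then -1 else 1

end Markers

section RowSum

variable {V : Type*} [Fintype V]

/-- Sum of a weight over the darts leaving `w`. -/
def rowSum (g : Mk → ℤ) (μ : V → V → Mk) (w : V) : ℤ := ∑ v, g (μ w v)

theorem rowSum_pos {g : Mk → ℤ} {μ : V → V → Mk} {w v : V} (h : ∀ x, 0 ≤ g (μ w x))
    (hv : 0 < g (μ w v)) : 0 < rowSum g μ w :=
  Finset.sum_pos' (fun x _ => h x) ⟨v, Finset.mem_univ v, hv⟩

theorem one_le_rowSum_ind {c : Mk} {μ : V → V → Mk} {w x : V} (hx : μ w x = c) :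
    1 ≤ rowSum (Mk.ind c) μ w :=
  rowSum_pos (fun _ => Mk.ind_nonneg _ _) (v := x) (by simp [hx, Mk.ind])

variable [DecidableEq V]

theorem two_le_rowSum_ind {c : Mk} {μ : V → V → Mk} {w x y : V} (hxy : x ≠ y) (hx : μ w x = c)
    (hy : μ w y = c) : 2 ≤ rowSum (Mk.ind c) μ w := by
  unfold rowSum
  calc (2 : ℤ) = ∑ v ∈ {x, y}, Mk.ind c (μ w v) := by
        rw [Finset.sum_pair hxy]; simp [hx, hy, Mk.ind]
    _ ≤ _ := Finset.sum_le_sum_of_subset_of_nonneg (Finset.subset_univ _)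
        fun v _ _ => Mk.ind_nonneg _ _

theorem rowSum_upd (g : Mk → ℤ) (μ : V → V → Mk) (a b : V) (c : Mk) (w : V) :
    rowSum g (upd μ a b c) w = rowSum g μ w + if w = a then g c - g (μ a b) else 0 := by
  unfold rowSum upd
  split_ifs with h
  · subst h
    rw [← Finset.add_sum_erase _ _ (Finset.mem_univ b),
      ← Finset.add_sum_erase (a := b) (f := fun v => g (μ w v)) _ (Finset.mem_univ b)]
    rw [Finset.sum_congr rfl (g := fun v => g (μ w v))]
    · simp only [and_self, if_true]
      ring
    · intro x hx
      simp [Finset.ne_of_mem_erase hx]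
  · simp [h]

theorem sum_rowSum_upd (g : Mk → ℤ) (μ : V → V → Mk) (a b : V) (c : Mk) :
    ∑ w, rowSum g (upd μ a b c) w = ∑ w, rowSum g μ w + (g c - g (μ a b)) := by
  simp [rowSum_upd, Finset.sum_add_distrib]

end RowSum

section Moves

variable {V : Type*}

/-- The part of the rule priority that only depends on the darts leaving `u`. -/
def RowSel (G : SimpleGraph V) (μ : V → V → Mk) (u v : V) : Prop :=
  G.Adj u v ∧ (μ u v = Mk.B ∨
    (∀ w, G.Adj u w → μ u w ≠ Mk.B) ∧ (μ u v = Mk.none ∨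
      (∀ w, G.Adj u w → μ u w ≠ Mk.none) ∧ (μ u v = Mk.F ∨
        (∀ w, G.Adj u w → μ u w ≠ Mk.F) ∧ μ u v = Mk.E)))

variable {G : SimpleGraph V} {μ μ' : V → V → Mk} {vis : Set V} {u v : V} {d : V × V}

theorem Sel.rowSel (h : Sel G μ u v) : RowSel G μ u v := by
  unfold Sel at h
  unfold RowSel
  tauto

theorem RowSel.congr (h : RowSel G μ u v) (hrow : ∀ w, μ' u w = μ u w) : RowSel G μ' u v := by
  unfold RowSel at *
  simpa only [hrow] using h

theorem exists_sel (h : ∃ v, G.Adj u v ∧ μ u v ≠ Mk.D) : ∃ v, Sel G μ u v := by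
  unfold Sel
  by_contra! hcon
  obtain ⟨v, hv, hD⟩ := h
  have h1 : ∀ w, G.Adj u w → μ u w ≠ Mk.B := fun w hw => (hcon w hw).1
  have h2 : ∀ w, G.Adj u w → ¬(μ u w = Mk.none ∧ μ w u = Mk.E) := fun w hw h =>
    (hcon w hw).2.1 h1 h.1 h.2
  have h3 : ∀ w, G.Adj u w → μ u w ≠ Mk.none := fun w hw => (hcon w hw).2.2.1 h1
    fun x hx h => not_and.1 (h2 x hx) h
  have h4 : ∀ w, G.Adj u w → μ u w ≠ Mk.F := fun w hw => (hcon w hw).2.2.2.1 h1 h3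
  have h5 : μ u v ≠ Mk.E := (hcon v hv).2.2.2.2 h1 h3 h4
  cases h : μ u v <;> grind

theorem exists_arrOK (o c : Mk) (p : Prop) : ∃ r, ArrOK o c p r := by
  unfold ArrOK
  by_cases h1 : o = Mk.none <;> by_cases h2 : c = Mk.E <;> by_cases h3 : p <;> simp [*]

variable [DecidableEq V]

/-- Complete traversal of the dart `d` by a single agent, where `vis` decides the marker written
on arrival through an unmarked edge. -/
structure Move (G : SimpleGraph V) (vis : Set V) (μ : V → V → Mk) (d : V × V)
    (μ' : V → V → Mk) : Prop where
  adj : G.Adj d.1 d.2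
  marks : (μ d.1 d.2 = Mk.none ∧ μ d.2 d.1 = Mk.none ∧
      ∃ r, ((d.2 ∈ vis ∧ r = Mk.B) ∨ (d.2 ∉ vis ∧ r = Mk.F)) ∧
        μ' = upd (upd μ d.1 d.2 Mk.E) d.2 d.1 r) ∨
    ((μ d.1 d.2 = Mk.E ∨ μ d.1 d.2 = Mk.F ∨ μ d.1 d.2 = Mk.B) ∧
      μ' = upd (upd μ d.1 d.2 Mk.D) d.2 d.1 Mk.D)

namespace Move

theorem of_arrOK {r : Mk} (hadj : G.Adj d.1 d.2) (hc : Compatible (μ d.1 d.2) (μ d.2 d.1))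
    (hD : μ d.1 d.2 ≠ Mk.D) (hr : ArrOK (μ d.1 d.2) (μ d.2 d.1) (d.2 ∈ vis) r) :
    Move G vis μ d (upd (upd μ d.1 d.2 (depMk (μ d.1 d.2))) d.2 d.1 r) := by
  refine ⟨hadj, ?_⟩
  unfold Compatible at hc
  unfold ArrOK at hr
  cases ho : μ d.1 d.2 <;> simp_all [depMk]
  exact ⟨r, hr, rfl⟩

theorem compatible (h : Move G vis μ d μ') (hμ : ∀ x y, Compatible (μ x y) (μ y x)) (x y : V) :
    Compatible (μ' x y) (μ' y x) := by
  have hne := h.adj.ne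
  have hxy := hμ x y
  rcases h.marks with ⟨_, _, r, hr, rfl⟩ | ⟨_, rfl⟩ <;> unfold upd Compatible at * <;> grind

theorem uses_eq (h : Move G vis μ d μ') (hμ : ∀ x y, Compatible (μ x y) (μ y x)) (x y : V) :
    (μ' x y).uses = (μ x y).uses + if d = (x, y) ∨ d = (y, x) then 1 else 0 := by
  obtain ⟨u, v⟩ := d
  have hne := h.adj.ne
  have huv := hμ u v
  rcases h.marks with ⟨_, _, r, hr, rfl⟩ | ⟨_, rfl⟩ <;> unfold upd Mk.uses Compatible at * <;>
    grind

theorem of_not_adj (h : Move G vis μ d μ') (hμ : ∀ x y, ¬ G.Adj x y → μ x y = Mk.none) (x y : V)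
    (hxy : ¬ G.Adj x y) : μ' x y = Mk.none := by
  have hadj := h.adj
  have hadj' := h.adj.symm
  rcases h.marks with ⟨_, _, r, hr, rfl⟩ | ⟨_, rfl⟩ <;> unfold upd <;> grind

theorem eq_of_ne (h : Move G vis μ d μ') {x y : V} (h1 : (x, y) ≠ d) (h2 : (y, x) ≠ d) :
    μ' x y = μ x y := by
  rcases h.marks with ⟨_, _, r, hr, rfl⟩ | ⟨_, rfl⟩ <;> unfold upd <;> grind

/-- The only new first-entry edge that a move creates is the one it traverses. -/
theorem tree_edge (h : Move G vis μ d μ') {x y : V} (hE : μ' x y = Mk.E) (hF : μ' y x = Mk.F) :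
    (μ x y = Mk.E ∧ μ y x = Mk.F) ∨ ((x, y) = d ∧ y ∉ vis) := by
  have hne := h.adj.ne
  rcases h.marks with ⟨_, _, r, hr, rfl⟩ | ⟨_, rfl⟩ <;> unfold upd at * <;> grind

theorem first_entry (h : Move G vis μ d μ') (hμ : ∀ x y, Compatible (μ x y) (μ y x)) {x y : V}
    (hF : μ x y = Mk.F) :
    μ' x y = Mk.F ∨ (x, y) = d ∨ ((y, x) = d ∧ μ d.1 d.2 = Mk.E) := by
  have hxy := hμ x y
  unfold Compatible at hxy
  rcases h.marks with ⟨_, _, r, hr, rfl⟩ | ⟨_, rfl⟩ <;> unfold upd at * <;> grind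

theorem flow_eq [Fintype V] (h : Move G vis μ d μ') (hμ : ∀ x y, Compatible (μ x y) (μ y x))
    (w : V) : rowSum Mk.flow μ' w = rowSum Mk.flow μ w +
      (μ d.1 d.2).sign * ((if w = d.1 then 1 else 0) - (if w = d.2 then 1 else 0)) := by
  have hne := h.adj.ne
  have hxy := hμ d.1 d.2
  rcases h.marks with ⟨_, _, r, hr, rfl⟩ | ⟨_, rfl⟩ <;> rw [rowSum_upd, rowSum_upd] <;>
    unfold upd Mk.flow Mk.sign Compatible at * <;> grind

theorem even_iff [Fintype V] (h : Move G vis μ d μ') (hμ : ∀ x y, Compatible (μ x y) (μ y x)) :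
    Even (∑ w, rowSum (Mk.ind Mk.E) μ' w) ↔ ¬ Even (∑ w, rowSum (Mk.ind Mk.E) μ w) := by
  have hne := h.adj.ne
  have hxy := hμ d.1 d.2
  have key : (∑ w, rowSum (Mk.ind Mk.E) μ' w) = ∑ w, rowSum (Mk.ind Mk.E) μ w + 1 ∨
      (∑ w, rowSum (Mk.ind Mk.E) μ' w) = ∑ w, rowSum (Mk.ind Mk.E) μ w - 1 := by
    rcases h.marks with ⟨_, _, r, hr, rfl⟩ | ⟨_, rfl⟩ <;>
      rw [sum_rowSum_upd, sum_rowSum_upd] <;>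
      unfold upd Mk.ind Compatible at * <;> grind
  rcases key with h | h <;> rw [h]
  · exact Int.even_add_one
  · exact Int.even_sub_one

end Move

end Moves

section Invariant

variable {V : Type*} [DecidableEq V]

/-- Number of agents located at `w`. -/
def agentsAt (s : St V) (w : V) : ℤ :=
  (if w = s.p1 then 1 else 0) + (if w = s.p2 then 1 else 0)

variable [Fintype V]

/-- Invariant of the reachable states: the once-traversed edges, directed from `E` to `F` or `B`,
form a flow of value two from the apex `a` to the agents; the first-entry edges among them increase
the rank `ρ`, and they reach every visited vertex that still has an unmarked dart. -/
structure Inv_s7 (G : SimpleGraph V) (a : V) (ρ : V → ℕ) (i : ℕ) (s : St V) : Prop where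
  not_adj : ∀ x y, ¬ G.Adj x y → s.μ x y = Mk.none
  compatible : ∀ x y, Compatible (s.μ x y) (s.μ y x)
  visited : ∀ x y, s.μ x y ≠ Mk.none → x ∈ s.vis
  p1_mem : s.p1 ∈ s.vis
  p2_mem : s.p2 ∈ s.vis
  balance : ∀ w, rowSum Mk.flow s.μ w + agentsAt s w = if w = a then 2 else 0
  backtrack : ∀ w, rowSum (Mk.ind Mk.B) s.μ w ≤ agentsAt s w
  rank_lt : ∀ x y, s.μ x y = Mk.E → s.μ y x = Mk.F → ρ x < ρ y
  rank_le : ∀ x ∈ s.vis, ρ x ≤ i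
  frontier : ∀ w ∈ s.vis, ∀ v, G.Adj w v → s.μ w v = Mk.none → w = a ∨ ∃ x, s.μ w x = Mk.F
  even : Even (∑ w, rowSum (Mk.ind Mk.E) s.μ w)

theorem inv_init (G : SimpleGraph V) (r : V) : Inv_s7 G r (fun _ => 0) 0 (init r) := by
  constructor <;> simp only [init, Compatible, rowSum, Mk.flow, agentsAt, Mk.ind]
  all_goals simp
  · intro w; by_cases hw : w = r <;> simp [hw]
  · intro w; by_cases hw : w = r <;> simp [hw]

variable {G : SimpleGraph V} {a : V} {ρ : V → ℕ} {i : ℕ} {s s' : St V} {d1 d2 : V × V}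

namespace Inv_s7

theorem eq_of_mark_B (h : Inv_s7 G a ρ i s) {x y : V} (hB : s.μ x y = Mk.B) :
    x = s.p1 ∨ x = s.p2 := by
  have h1 := one_le_rowSum_ind hB
  have h2 := h.backtrack x
  unfold agentsAt at h2
  grind

/-- Two agents never cross on a once-traversed edge. -/
theorem not_crossing (h : Inv_s7 G a ρ i s) {u v : V} (huv : u ≠ v)
    (hp : ∀ w, agentsAt s w = (if w = u then 1 else 0) + (if w = v then 1 else 0))
    (hu : RowSel G s.μ u v) (hE : s.μ u v = Mk.E) (hv : RowSel G s.μ v u) : False := by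
  have hcomp := h.compatible
  have hna := h.not_adj
  have huB : ∀ w, s.μ u w ≠ Mk.B := by unfold RowSel at hu; grind
  have huF : ∀ w, s.μ u w ≠ Mk.F := by unfold RowSel at hu; grind
  have hvB : ∀ w, s.μ v w = Mk.B → s.μ v u = Mk.B := by unfold RowSel at hv; grind
  have hB : ∀ x y, s.μ x y = Mk.B → x = v ∧ y = u := by
    intro x y hxy
    have h1 := one_le_rowSum_ind hxy
    have h2 := h.backtrack x
    rw [hp] at h2
    have hx : x = v := by grind
    subst hx
    refine ⟨rfl, ?_⟩
    by_contra hy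
    have h3 := two_le_rowSum_ind hy hxy (hvB y hxy)
    grind
  let S : Finset (V × V) := Finset.univ.filter fun e => s.μ e.1 e.2 = Mk.E ∧ e ≠ (u, v)
  have hS : S = ∅ := by
    by_contra hne
    obtain ⟨⟨x, y⟩, hxy, hmax⟩ :=
      Finset.exists_max_image S (fun e => ρ e.2) (Finset.nonempty_iff_ne_empty.2 hne)
    simp only [S, Finset.mem_filter, Finset.mem_univ, true_and, ne_eq] at hxy hmax
    have hyx : s.μ y x = Mk.F := by
      have := hcomp x y
      unfold Compatible at this
      grind
    have hyu : y ≠ u := by grind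
    have hyE : ∀ z, s.μ y z ≠ Mk.E := by
      intro z hz
      have hzy : s.μ z y = Mk.F := by
        have := hcomp y z
        unfold Compatible at this
        grind
      have := h.rank_lt y z hz hzy
      have := hmax (y, z) ⟨hz, by grind⟩
      grind
    have hle : ∀ z, (s.μ y z).flow ≤ 0 := fun z => Mk.flow_nonpos (hyE z)
    have hbal := h.balance y
    rw [hp] at hbal
    have hneg : rowSum Mk.flow s.μ y < 0 := by
      unfold rowSum
      exact Finset.sum_neg' (fun z _ => hle z) ⟨x, Finset.mem_univ x, by simp [hyx, Mk.flow]⟩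
    have hyv : y = v := by grind
    subst hyv
    have hxu : x ≠ u := by grind
    have hyu' : (s.μ y u).flow = -1 := by
      have := hcomp u y
      unfold Compatible at this
      unfold Mk.flow
      grind
    have h2 : rowSum Mk.flow s.μ y ≤ -2 := by
      have hsub := Finset.sum_le_sum_of_subset_of_nonneg (f := fun z => -(s.μ y z).flow)
        (Finset.subset_univ {x, u}) fun z _ _ => neg_nonneg.2 (hle z)
      have hyx' : (s.μ y x).flow = -1 := by rw [hyx]; rfl
      rw [Finset.sum_pair hxu, hyu', hyx', Finset.sum_neg_distrib] at hsub
      unfold rowSum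
      linarith
    grind
  have hone : ∑ w, rowSum (Mk.ind Mk.E) s.μ w = 1 := by
    have h1 : ∀ x y, Mk.ind Mk.E (s.μ x y) = if x = u ∧ y = v then 1 else 0 := by
      intro x y
      have : (x, y) ∉ S := by simp [hS]
      simp only [S, Finset.mem_filter, Finset.mem_univ, true_and] at this
      unfold Mk.ind
      grind
    simp only [rowSum, h1, ite_and]
    simp
  have := h.even
  rw [hone] at this
  exact absurd this (by decide)

/-- When the agents are co-located at a vertex all of whose edges are done, so are all edges. -/
theorem done (h : Inv_s7 G a ρ i s) (hG : G.Connected) (hp : s.p1 = s.p2)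
    (hD : ∀ v, G.Adj s.p1 v → s.μ s.p1 v = Mk.D) {x y : V} (hxy : G.Adj x y) :
    s.μ x y = Mk.D := by
  have hcomp := h.compatible
  have hna := h.not_adj
  have hw : ∀ v, s.μ s.p1 v = Mk.none ∨ s.μ s.p1 v = Mk.D := fun v => by
    by_cases hv : G.Adj s.p1 v
    · exact Or.inr (hD v hv)
    · exact Or.inl (hna _ _ hv)
  have ha : s.p1 = a := by
    have h1 := h.balance s.p1
    have h2 : rowSum Mk.flow s.μ s.p1 = 0 := by
      refine Finset.sum_eq_zero fun v _ => ?_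
      rcases hw v with h | h <;> rw [h] <;> rfl
    unfold agentsAt at h1
    grind
  have hB : ∀ x y, s.μ x y ≠ Mk.B := by
    intro x y hxy
    have := h.eq_of_mark_B hxy
    have := hw y
    grind
  let S : Finset (V × V) := Finset.univ.filter fun e => s.μ e.1 e.2 = Mk.E
  have hS : S = ∅ := by
    by_contra hne
    obtain ⟨⟨x, y⟩, hxy, hmin⟩ :=
      Finset.exists_min_image S (fun e => ρ e.1) (Finset.nonempty_iff_ne_empty.2 hne)
    simp only [S, Finset.mem_filter, Finset.mem_univ, true_and] at hxy hmin
    have hxF : ∀ z, s.μ x z ≠ Mk.F := by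
      intro z hz
      have hzx : s.μ z x = Mk.E := by
        have := hcomp x z
        unfold Compatible at this
        grind
      have := h.rank_lt z x hzx hz
      have := hmin (z, x) hzx
      grind
    have hpos : 0 < rowSum Mk.flow s.μ x :=
      rowSum_pos (fun z => Mk.flow_nonneg (hxF z) (hB x z)) (v := y) (by simp [hxy, Mk.flow])
    have hbal := h.balance x
    have hx : x = a := by unfold agentsAt at hbal; grind
    have := hw y
    grind
  have hE : ∀ x y, s.μ x y ≠ Mk.E := fun x y hxy => by
    have : (x, y) ∉ S := by simp [hS]
    simp [S, hxy] at this
  have hF : ∀ x y, s.μ x y ≠ Mk.F := fun x y hxy => by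
    have := hcomp x y
    have := hE y x
    unfold Compatible at *
    grind
  have hvisD : ∀ x ∈ s.vis, ∀ y, G.Adj x y → s.μ x y = Mk.D := by
    intro x hx y hxy
    have h1 := h.frontier x hx y hxy
    have h2 := hw y
    have h3 := hD y
    have := hE x y
    have := hF x
    have := hB x y
    cases hz : s.μ x y <;> grind
  have hwalk : ∀ {u v}, G.Walk u v → u ∈ s.vis → v ∈ s.vis := by
    intro u v p
    induction p with
    | nil => exact id
    | @cons u v w huv p ih =>
      intro hu
      have h1 := hvisD _ hu _ huv
      have h2 := hcomp u v
      exact ih (h.visited v u (by unfold Compatible at h2; grind))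
  obtain ⟨p⟩ := hG.preconnected s.p1 x
  exact hvisD x (hwalk p h.p1_mem) y hxy

end Inv_s7

end Invariant

section Step

variable {V : Type*} [DecidableEq V] {G : SimpleGraph V} {a : V} {ρ : V → ℕ} {i : ℕ}
  {s s' : St V} {d1 d2 : V × V}

/-- The second agent may be taken to select after the first agent's departure update, whether or
not the agents are co-located. -/
theorem SyncStep.rowSel (h : SyncStep G s d1 d2 s') :
    d1.1 = s.p1 ∧ d2.1 = s.p2 ∧ RowSel G s.μ d1.1 d1.2 ∧ RowSel G (μdep1 s d1) d2.1 d2.2 := by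
  obtain ⟨h1, h2, hs1, hs2, -⟩ := h
  rw [← h1] at hs1
  refine ⟨h1, h2, hs1.rowSel, ?_⟩
  rcases hs2 with ⟨hne, hs2⟩ | ⟨-, hs2⟩ <;> rw [← h2] at hs2
  · refine hs2.rowSel.congr fun w => ?_
    unfold μdep1 upd
    grind
  · exact hs2.rowSel

variable [Fintype V]

namespace Inv_s7

theorem apex_of_first (h : Inv_s7 G a ρ i s) (hs : SyncStep G s d1 d2 s') (hE : o1 s d1 = Mk.E) :
    s.p1 = a ∧ s.p2 ≠ s.p1 := by
  obtain ⟨h1, h2, hs1, hs2⟩ := hs.rowSel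
  have hna := h.not_adj
  have hbal := h.balance d1.1
  unfold o1 at hE
  have hpos : 0 < rowSum Mk.flow s.μ d1.1 := by
    refine rowSum_pos (fun x => Mk.flow_nonneg ?_ ?_) (v := d1.2) (by simp [hE, Mk.flow]) <;>
      unfold RowSel at hs1 <;> grind
  unfold agentsAt at hbal
  grind

theorem apex_of_second (h : Inv_s7 G a ρ i s) (hs : SyncStep G s d1 d2 s')
    (hE : o2 s d1 d2 = Mk.E) : s.p2 = a ∧ o1 s d1 ≠ Mk.E := by
  obtain ⟨h1, h2, hs1, hs2⟩ := hs.rowSel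
  have hna := h.not_adj
  have hbal := h.balance d2.1
  have hfirst := h.apex_of_first hs
  unfold o2 at hE
  have hpos : 0 < rowSum Mk.flow (μdep1 s d1) d2.1 := by
    refine rowSum_pos (fun x => Mk.flow_nonneg ?_ ?_) (v := d2.2) (by simp [hE, Mk.flow]) <;>
    · have := hs1.1
      unfold RowSel at hs2
      by_cases hx : G.Adj d2.1 x
      · grind
      · have : μdep1 s d1 d2.1 x = s.μ d2.1 x := by unfold μdep1 upd; grind
        grind
  unfold μdep1 at hpos
  rw [rowSum_upd] at hpos
  unfold agentsAt at hbal
  unfold o1 at *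
  cases ho : s.μ d1.1 d1.2 <;> simp only [ho, depMk, Mk.flow] at hpos <;> grind

theorem exists_moves (h : Inv_s7 G a ρ i s) (hs : SyncStep G s d1 d2 s') :
    ∃ m, Move G s.vis s.μ d1 m ∧ Move G s.vis m d2 s'.μ ∧
      (m d2.1 d2.2 = o2 s d1 d2 ∨
        o2 s d1 d2 = Mk.none ∧ m d2.1 d2.2 = Mk.B ∧ d2.2 ∈ s.vis) := by
  obtain ⟨h1, h2, hs1, hs2⟩ := hs.rowSel
  obtain ⟨-, -, -, -, r1, r2, hr1, hr2, rfl⟩ := hs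
  have hne1 := hs1.1.ne
  have hne2 := hs2.1.ne
  have hc1 := h.compatible d1.1 d1.2
  have hc2 := h.compatible d2.1 d2.2
  have hn1 : s.μ d1.1 d1.2 ≠ Mk.D := by unfold RowSel at hs1; grind
  have hn2 : o2 s d1 d2 ≠ Mk.D := by unfold RowSel at hs2; unfold o2; grind
  have hp1 := h.p1_mem
  have hp2 := h.p2_mem
  by_cases hsame : d1 = d2
  · subst hsame
    have ho : s.μ d1.1 d1.2 = Mk.none := by
      cases ho : s.μ d1.1 d1.2 <;> simp_all [o2, μdep1, o1, upd, depMk]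
    have hc : s.μ d1.2 d1.1 = Mk.none := by unfold Compatible at hc1; grind
    have ho2 : o2 s d1 d1 = Mk.E := by simp [o2, μdep1, o1, upd, ho, depMk]
    have hr : r2 = Mk.D := by unfold ArrOK at hr2; grind
    have hr1' : (d1.2 ∈ s.vis ∧ r1 = Mk.B) ∨ (d1.2 ∉ s.vis ∧ r1 = Mk.F) := by
      have hd : μdep s d1 d1 d1.2 d1.1 = Mk.none := by unfold μdep μdep1 upd; grind
      unfold ArrOK o1 at hr1
      grind
    refine ⟨upd (upd s.μ d1.1 d1.2 Mk.E) d1.2 d1.1 r1,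
      ⟨hs1.1, Or.inl ⟨ho, hc, _, hr1', rfl⟩⟩, ⟨hs1.1, Or.inr ⟨?_, ?_⟩⟩, Or.inl ?_⟩
    · unfold upd; grind
    · funext x y
      simp only [μdep, ho2, μdep1, hr, depMk]
      unfold upd
      grind
    · rw [ho2]; unfold upd; grind
  by_cases hswap : d2 = d1.swap
  · subst hswap
    have hs2' : RowSel G s.μ d1.2 d1.1 := hs2.congr fun w => by unfold μdep1 upd; grind
    have hagents : ∀ w, agentsAt s w = (if w = d1.1 then 1 else 0) + (if w = d1.2 then 1 else 0) :=
      fun w => by unfold agentsAt; grind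
    have hx1 := fun hE => h.not_crossing hne1 hagents hs1 hE hs2'
    have hx2 := fun hE => h.not_crossing hne1.symm (fun w => by rw [hagents, add_comm]) hs2' hE hs1
    have ho : s.μ d1.1 d1.2 = Mk.none ∧ s.μ d1.2 d1.1 = Mk.none := by
      unfold Compatible at hc1; grind
    have ho1 : o1 s d1 = Mk.none := ho.1
    have ho2 : o2 s d1 d1.swap = Mk.none := by
      unfold o2 μdep1 upd; grind
    have hr : r1 = Mk.D ∧ r2 = Mk.D := by
      simp only [μdep, μdep1, ho1, ho2, depMk] at hr1 hr2
      unfold ArrOK upd at hr1 hr2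
      grind
    refine ⟨upd (upd s.μ d1.1 d1.2 Mk.E) d1.2 d1.1 Mk.B,
      ⟨hs1.1, Or.inl ⟨ho.1, ho.2, _, ?_, rfl⟩⟩, ⟨hs2.1, Or.inr ⟨?_, ?_⟩⟩, Or.inr ⟨ho2, ?_, ?_⟩⟩
    · grind
    · unfold upd; grind
    · funext x y
      simp only [μdep, μdep1, hr]
      unfold upd
      grind
    · unfold upd; grind
    · grind
  have ho2 : o2 s d1 d2 = s.μ d2.1 d2.2 := by
    unfold o2 μdep1 upd; grind
  have hm1 : μdep s d1 d2 d1.2 d1.1 = s.μ d1.2 d1.1 := by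
    unfold μdep μdep1 upd; grind
  have hm2 : μdep s d1 d2 d2.2 d2.1 = s.μ d2.2 d2.1 := by
    unfold μdep μdep1 upd; grind
  rw [hm1] at hr1
  rw [hm2, ho2] at hr2
  rw [ho2] at hn2
  unfold o1 at hr1
  refine ⟨_, Move.of_arrOK hs1.1 hc1 hn1 hr1, ?_, Or.inl ?_⟩
  · have hm : ∀ r, upd (upd s.μ d1.1 d1.2 (depMk (s.μ d1.1 d1.2))) d1.2 d1.1 r d2.1 d2.2 =
        s.μ d2.1 d2.2 := fun r => by unfold upd; grind
    have hm' : ∀ r, upd (upd s.μ d1.1 d1.2 (depMk (s.μ d1.1 d1.2))) d1.2 d1.1 r d2.2 d2.1 =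
        s.μ d2.2 d2.1 := fun r => by unfold upd; grind
    convert Move.of_arrOK (r := r2) hs2.1 ?_ ?_ ?_ using 1
    · funext x y
      simp only [μdep, ho2, μdep1, o1, hm]
      unfold upd
      grind
    · rwa [hm, hm']
    · rwa [hm]
    · rwa [hm, hm']
  · rw [ho2]; unfold upd; grind

/-- Backtracking has priority: no backtrack marker survives the departures. -/
theorem μdep_ne_B (h : Inv_s7 G a ρ i s) (hs : SyncStep G s d1 d2 s') (x y : V) :
    μdep s d1 d2 x y ≠ Mk.B := by
  intro hxy
  obtain ⟨h1, h2, hs1, hs2⟩ := hs.rowSel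
  have hna := h.not_adj
  have hdep : ∀ c, depMk c ≠ Mk.B := fun c => by cases c <;> simp [depMk]
  have hxy1 : μdep1 s d1 x y = Mk.B := by unfold μdep upd at hxy; grind
  have hxy0 : s.μ x y = Mk.B := by unfold μdep1 upd at hxy1; grind
  have hadj : G.Adj x y := by
    by_contra hn
    simp [hna x y hn] at hxy0
  have hb1 : x = d1.1 → s.μ d1.1 d1.2 = Mk.B := by unfold RowSel at hs1; grind
  have hb2 : x = d2.1 → μdep1 s d1 d2.1 d2.2 = Mk.B := by unfold RowSel at hs2; grind
  have hpos := one_le_rowSum_ind hxy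
  have hle := h.backtrack x
  have hind : ∀ c, Mk.ind Mk.B (depMk c) = 0 := fun c => if_neg (hdep c)
  unfold μdep at hpos
  rw [rowSum_upd] at hpos
  unfold o2 at hpos
  nth_rewrite 1 [μdep1] at hpos
  rw [rowSum_upd, hind, hind] at hpos
  unfold agentsAt at hle
  rw [← h1, ← h2] at hle
  unfold Mk.ind at *
  split_ifs at * <;> grind

theorem step (h : Inv_s7 G a ρ i s) (hs : SyncStep G s d1 d2 s') :
    ∃ a' ρ', Inv_s7 G a' ρ' (i + 1) s' := by
  classical
  obtain ⟨h1, h2, hs1, hs2⟩ := hs.rowSel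
  obtain ⟨m, hm1, hm2, hmo⟩ := h.exists_moves hs
  have hcm := hm1.compatible h.compatible
  have hE1 := h.apex_of_first hs
  have hE2 := h.apex_of_second hs
  have hp1 := h.p1_mem
  have hp2 := h.p2_mem
  obtain ⟨r1, r2, -, -, hs'⟩ := hs.2.2.2.2
  have hq1 : s'.p1 = d1.2 := by rw [hs']
  have hq2 : s'.p2 = d2.2 := by rw [hs']
  have hμ : s'.μ = upd (upd (μdep s d1 d2) d1.2 d1.1 r1) d2.2 d2.1 r2 := by rw [hs']
  have hvis : ∀ x, x ∈ s'.vis ↔ x ∈ s.vis ∨ (s.μ d1.1 d1.2 = Mk.none ∧ x = d1.2) ∨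
      (o2 s d1 d2 = Mk.none ∧ x = d2.2) := by
    intro x; rw [hs']; rfl
  clear hs'
  have hv1 : d1.2 ∈ s'.vis := by
    have := h.compatible d1.1 d1.2
    have := h.visited d1.2 d1.1
    unfold Compatible at *
    grind
  have hsub : ∀ x ∈ s.vis, x ∈ s'.vis := fun x hx => (hvis x).2 (Or.inl hx)
  have hmv : ∀ {x y}, m x y ≠ Mk.none → x ∈ s'.vis := fun {x y} hxy => by
    by_cases e1 : (x, y) = d1
    · rw [show x = d1.1 by rw [← e1], h1]
      exact hsub _ hp1
    by_cases e2 : (y, x) = d1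
    · rwa [show x = d1.2 by rw [← e2]]
    rw [hm1.eq_of_ne e1 e2] at hxy
    exact hsub _ (h.visited x y hxy)
  have hv2 : d2.2 ∈ s'.vis := by
    have := hcm d2.1 d2.2
    have := @hmv d2.2 d2.1
    unfold Compatible at *
    grind
  have hsv : ∀ {x y}, s'.μ x y ≠ Mk.none → x ∈ s'.vis := fun {x y} hxy => by
    by_cases e1 : (x, y) = d2
    · rw [show x = d2.1 by rw [← e1], h2]
      exact hsub _ hp2
    by_cases e2 : (y, x) = d2
    · rwa [show x = d2.2 by rw [← e2]]
    rw [hm2.eq_of_ne e1 e2] at hxy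
    exact hmv hxy
  refine ⟨if o1 s d1 = Mk.E then d1.2 else if o2 s d1 d2 = Mk.E then d2.2 else a,
    fun v => if v ∈ s.vis then ρ v else i + 1, ?_⟩
  constructor
  · exact hm2.of_not_adj (hm1.of_not_adj h.not_adj)
  · exact hm2.compatible hcm
  · exact fun x y hxy => hsv hxy
  · rwa [hq1]
  · rwa [hq2]
  · intro w
    have hb := h.balance w
    rw [hm2.flow_eq hcm, hm1.flow_eq h.compatible]
    have hσ1 : (s.μ d1.1 d1.2).sign = if o1 s d1 = Mk.E then -1 else 1 := rfl
    have hσ2 : (m d2.1 d2.2).sign = if o2 s d1 d2 = Mk.E then -1 else 1 := by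
      unfold Mk.sign; grind
    rw [hσ1, hσ2]
    unfold agentsAt at *
    rw [hq1, hq2]
    rw [h1, h2]
    clear hm1 hm2 hcm
    split_ifs at * <;> grind
  · intro w
    rw [hμ, rowSum_upd, rowSum_upd]
    have hdep : rowSum (Mk.ind Mk.B) (μdep s d1 d2) w = 0 :=
      Finset.sum_eq_zero fun v _ => if_neg (h.μdep_ne_B hs w v)
    have hle : ∀ c d : Mk, Mk.ind Mk.B c - Mk.ind Mk.B d ≤ 1 := fun c d => by
      unfold Mk.ind; split_ifs <;> simp
    rw [hdep]
    unfold agentsAt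
    rw [hq1, hq2]
    have := hle r1 (μdep s d1 d2 d1.2 d1.1)
    have := hle r2 (upd (μdep s d1 d2) d1.2 d1.1 r1 d2.2 d2.1)
    split_ifs <;> linarith
  · intro x y hE hF
    have hlt := h.rank_lt x y
    have hle := h.rank_le x
    rcases hm2.tree_edge hE hF with ⟨hE, hF⟩ | ⟨hd, hy⟩
    · rcases hm1.tree_edge hE hF with ⟨hE, hF⟩ | ⟨hd, hy⟩
      · have := h.visited x y
        have := h.visited y x
        grind
      · grind
    · grind
  · intro x hx
    have := h.rank_le x
    grind
  · intro w hw v hwv hnone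
    have huses : ∀ c : Mk, c.uses = 0 ↔ c = Mk.none := fun c => by cases c <;> simp [Mk.uses]
    have hmn : m w v = Mk.none := by
      rw [← huses] at hnone ⊢
      rw [hm2.uses_eq hcm w v] at hnone
      omega
    have hsn : s.μ w v = Mk.none := by
      rw [← huses] at hmn ⊢
      rw [hm1.uses_eq h.compatible w v] at hmn
      omega
    have hne1 : ¬ (w = d1.1 ∧ v = d1.2) := by
      rintro ⟨rfl, rfl⟩
      have hu := hm1.uses_eq h.compatible d1.1 d1.2
      rw [hmn, hsn] at hu
      simp [Mk.uses] at hu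
    have hd1 : d1.1 = w → o1 s d1 ≠ Mk.F ∧ o1 s d1 ≠ Mk.E := by
      unfold RowSel at hs1
      unfold o1
      grind
    have hd2 : d2.1 = w → o2 s d1 d2 ≠ Mk.F ∧ o2 s d1 d2 ≠ Mk.E := by
      have : μdep1 s d1 w v = Mk.none := by unfold μdep1 upd; rwa [if_neg hne1]
      unfold RowSel at hs2
      unfold o2
      grind
    have ho1 : o1 s d1 = s.μ d1.1 d1.2 := rfl
    by_cases hwv : w ∈ s.vis
    · rcases h.frontier w hwv v ‹_› hsn with hwa | ⟨x, hx⟩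
      · grind
      · rcases hm1.first_entry h.compatible hx with hx | hx | hx
        · rcases hm2.first_entry hcm hx with hx | hx | hx
          · exact Or.inr ⟨x, hx⟩
          · grind
          · grind
        · grind
        · grind
    · rcases (hvis w).1 hw with hw | ⟨hw, rfl⟩ | ⟨hw, rfl⟩
      · exact absurd hw hwv
      · have hF : m d1.2 d1.1 = Mk.F := by
          rcases hm1.marks with ⟨_, _, r, hr, rfl⟩ | ⟨_, rfl⟩ <;> unfold upd <;> grind
        rcases hm2.first_entry hcm hF with hx | hx | hx
        · exact Or.inr ⟨_, hx⟩
        · grind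
        · grind
      · have hF : s'.μ d2.2 d2.1 = Mk.F := by
          rcases hm2.marks with ⟨_, _, r, hr, hmk⟩ | ⟨_, hmk⟩ <;> rw [hmk] <;> unfold upd <;> grind
        exact Or.inr ⟨_, hF⟩
  · rw [hm2.even_iff hcm, hm1.even_iff h.compatible, not_not]
    exact h.even

end Inv_s7

end Step

section Execution

variable {V : Type*} [Fintype V] {G : SimpleGraph V}

/-- A vertex whose darts carry flow has a dart that is not done. -/
theorem exists_ne_D_of_rowSum {μ : V → V → Mk} {w : V}
    (hna : ∀ x y, ¬ G.Adj x y → μ x y = Mk.none) (h : rowSum Mk.flow μ w ≠ 0) :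
    ∃ v, G.Adj w v ∧ μ w v ≠ Mk.D := by
  obtain ⟨v, -, hv⟩ := Finset.exists_ne_zero_of_sum_ne_zero h
  refine ⟨v, ?_, ?_⟩
  · by_contra hadj
    simp [hna _ _ hadj, Mk.flow] at hv
  · intro hD
    simp [hD, Mk.flow] at hv

variable [DecidableEq V] {a : V} {ρ : V → ℕ} {i : ℕ}
  {s s' : St V} {d1 d2 : V × V}

theorem Inv_s7.uses_step (h : Inv_s7 G a ρ i s) (hs : SyncStep G s d1 d2 s') (x y : V) :
    (s'.μ x y).uses = (s.μ x y).uses + (if d1 = (x, y) ∨ d1 = (y, x) then 1 else 0) +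
      (if d2 = (x, y) ∨ d2 = (y, x) then 1 else 0) := by
  obtain ⟨m, hm1, hm2, -⟩ := h.exists_moves hs
  rw [hm2.uses_eq (hm1.compatible h.compatible), hm1.uses_eq h.compatible]

/-- An execution only gets stuck when the agents are co-located and every edge there is done. -/
theorem Inv_s7.stuck (h : Inv_s7 G a ρ i s) (hmax : ∀ e1 e2 s', ¬ SyncStep G s e1 e2 s') :
    s.p1 = s.p2 ∧ ∀ v, G.Adj s.p1 v → s.μ s.p1 v = Mk.D := by
  have hno : ∀ v1 v2, Sel G s.μ s.p1 v1 → ¬ ((s.p1 ≠ s.p2 ∧ Sel G s.μ s.p2 v2) ∨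
      (s.p1 = s.p2 ∧ Sel G (μdep1 s (s.p1, v1)) s.p2 v2)) := by
    intro v1 v2 hv1 hv2
    obtain ⟨r1, hr1⟩ := exists_arrOK (o1 s (s.p1, v1)) (μdep s (s.p1, v1) (s.p2, v2) v1 s.p1)
      (v1 ∈ s.vis)
    obtain ⟨r2, hr2⟩ := exists_arrOK (o2 s (s.p1, v1) (s.p2, v2))
      (μdep s (s.p1, v1) (s.p2, v2) v2 s.p2) (v2 ∈ s.vis)
    exact hmax (s.p1, v1) (s.p2, v2) _ ⟨rfl, rfl, hv1, hv2, r1, r2, hr1, hr2, rfl⟩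
  have hb1 := h.balance s.p1
  have hb2 := h.balance s.p2
  unfold agentsAt at hb1 hb2
  have hp : s.p1 = s.p2 := by
    by_contra hne
    obtain ⟨v1, hv1⟩ := exists_sel (exists_ne_D_of_rowSum (w := s.p1) h.not_adj (by grind))
    obtain ⟨v2, hv2⟩ := exists_sel (exists_ne_D_of_rowSum (w := s.p2) h.not_adj (by grind))
    exact hno v1 v2 hv1 (Or.inl ⟨hne, hv2⟩)
  refine ⟨hp, fun v hv => ?_⟩
  by_contra hD
  obtain ⟨v1, hv1⟩ := exists_sel ⟨v, hv, hD⟩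
  have hne : s.μ s.p1 v1 ≠ Mk.D := by
    have := hv1.rowSel
    unfold RowSel at this
    grind
  have hflow : rowSum Mk.flow (μdep1 s (s.p1, v1)) s.p1 ≠ 0 ∨ s.μ s.p1 v1 = Mk.none := by
    unfold μdep1
    rw [rowSum_upd]
    simp only [o1]
    cases ho : s.μ s.p1 v1 <;> simp only [depMk, Mk.flow] <;> grind
  have hna : ∀ x y, ¬ G.Adj x y → μdep1 s (s.p1, v1) x y = Mk.none := by
    intro x y hxy
    have := h.not_adj x y hxy
    have := hv1.1
    unfold μdep1 upd
    grind
  have hex : ∃ v, G.Adj s.p1 v ∧ μdep1 s (s.p1, v1) s.p1 v ≠ Mk.D := by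
    rcases hflow with hflow | hnone
    · exact exists_ne_D_of_rowSum hna hflow
    · exact ⟨v1, hv1.1, by simp [μdep1, o1, upd, hnone, depMk]⟩
  obtain ⟨v2, hv2⟩ := exists_sel hex
  exact hno v1 v2 hv1 (Or.inr ⟨hp, hp ▸ hv2⟩)

section Run

variable {r : V} {k : ℕ} {f : ℕ → St V} {e1 e2 : ℕ → V × V}

theorem exists_inv (h0 : f 0 = init r)
    (hstep : ∀ i < k, SyncStep G (f i) (e1 i) (e2 i) (f (i + 1))) :
    ∀ i ≤ k, ∃ a ρ, Inv_s7 G a ρ i (f i) := by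
  intro i
  induction i with
  | zero => exact fun _ => ⟨r, _, h0 ▸ inv_init G r⟩
  | succ i ih =>
    intro hi
    obtain ⟨a, ρ, h⟩ := ih (Nat.le_of_succ_le hi)
    exact h.step (hstep i hi)

theorem uses_eq_traversals (h0 : f 0 = init r)
    (hstep : ∀ i < k, SyncStep G (f i) (e1 i) (e2 i) (f (i + 1))) (u v : V) :
    ∀ i ≤ k, ((f i).μ u v).uses =
      ((Finset.range i).filter fun j => e1 j = (u, v) ∨ e1 j = (v, u)).card +
      ((Finset.range i).filter fun j => e2 j = (u, v) ∨ e2 j = (v, u)).card := by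
  intro i
  induction i with
  | zero => simp [h0, init, Mk.uses]
  | succ i ih =>
    intro hi
    obtain ⟨a, ρ, h⟩ := exists_inv h0 hstep i (Nat.le_of_succ_le hi)
    rw [h.uses_step (hstep i hi), ih (Nat.le_of_succ_le hi), Finset.range_add_one,
      Finset.filter_insert, Finset.filter_insert]
    split_ifs <;> simp <;> ring

theorem sum_uses (h0 : f 0 = init r)
    (hstep : ∀ i < k, SyncStep G (f i) (e1 i) (e2 i) (f (i + 1))) :
    ∀ i ≤ k, ∑ x, ∑ y, ((f i).μ x y).uses = 4 * i := by
  intro i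
  induction i with
  | zero => simp [h0, init, Mk.uses]
  | succ i ih =>
    intro hi
    obtain ⟨a, ρ, h⟩ := exists_inv h0 hstep i (Nat.le_of_succ_le hi)
    have hdart : ∀ d : V × V, d.1 ≠ d.2 →
        ∑ x, ∑ y, (if d = (x, y) ∨ d = (y, x) then 1 else 0) = 2 := by
      rintro ⟨u, v⟩ huv
      have hsplit : ∀ x y : V, (if (u, v) = (x, y) ∨ (u, v) = (y, x) then 1 else 0) =
          (if u = x then if v = y then 1 else 0 else 0) +
          (if v = x then if u = y then 1 else 0 else 0) := by
        intro x y
        grind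
      simp only [hsplit, Finset.sum_add_distrib]
      have hcol : ∀ p q x : V, ∑ y, (if p = x then if q = y then 1 else 0 else 0) =
          if p = x then 1 else 0 := fun p q x => by split_ifs <;> simp
      simp [hcol]
    obtain ⟨-, -, hs1, hs2⟩ := (hstep i hi).rowSel
    simp only [h.uses_step (hstep i hi), Finset.sum_add_distrib]
    rw [ih (Nat.le_of_succ_le hi), hdart _ hs1.1.ne, hdart _ hs2.1.ne]
    ring

end Run

end Execution

end TwoExplore

open TwoExplore in
/-- Every maximal synchronous execution of the two-agent
exploration algorithm lasts exactly `m` time-steps; at termination every edge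
has been traversed exactly twice and the two agents are co-located. -/
theorem two_agent_sync_exploration {V : Type*} [Fintype V] [DecidableEq V]
    (G : SimpleGraph V) [Fintype G.edgeSet] (hG : G.Connected) (r : V)
    (k : ℕ) (f : ℕ → St V) (d1 d2 : ℕ → V × V)
    (h0 : f 0 = init r)
    (hstep : ∀ i < k, SyncStep G (f i) (d1 i) (d2 i) (f (i + 1)))
    (hmax : ∀ e1 e2 s', ¬ SyncStep G (f k) e1 e2 s') :
    k = G.edgeFinset.card ∧
    (f k).p1 = (f k).p2 ∧
    ∀ u v : V, G.Adj u v →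
      ((Finset.range k).filter fun i => d1 i = (u, v) ∨ d1 i = (v, u)).card +
      ((Finset.range k).filter fun i => d2 i = (u, v) ∨ d2 i = (v, u)).card = 2 := by
  classical
  obtain ⟨a, ρ, h⟩ := exists_inv h0 hstep k le_rfl
  obtain ⟨hp, hD⟩ := h.stuck hmax
  have hall : ∀ u v, G.Adj u v → (f k).μ u v = Mk.D := fun u v => h.done hG hp hD
  refine ⟨?_, hp, fun u v huv => ?_⟩
  · have hsum := sum_uses h0 hstep k le_rfl
    have hdeg : ∀ x, ∑ y, ((f k).μ x y).uses = 2 * G.degree x := by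
      intro x
      have huses : ∀ y, ((f k).μ x y).uses = if G.Adj x y then 2 else 0 := by
        intro y
        split_ifs with hxy
        · rw [hall x y hxy]; rfl
        · rw [h.not_adj x y hxy]; rfl
      simp only [huses, ← Finset.sum_filter, Finset.sum_const, smul_eq_mul,
        ← SimpleGraph.card_neighborFinset_eq_degree, SimpleGraph.neighborFinset_eq_filter]
      ring
    simp only [hdeg, ← Finset.mul_sum] at hsum
    rw [SimpleGraph.sum_degrees_eq_twice_card_edges] at hsum
    have hcard : ∀ (i₁ i₂ : Fintype G.edgeSet),
        (@SimpleGraph.edgeFinset V G i₁).card = (@SimpleGraph.edgeFinset V G i₂).card :=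
      fun i₁ i₂ => by congr!
    rw [hcard _ ‹Fintype G.edgeSet›] at hsum
    omega
  · rw [← uses_eq_traversals h0 hstep u v k le_rfl, hall u v huv]
    rfl
end
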